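/- Let P be a 4-blocked point set and let A be a set of three points of P all assigned the same colour. Then P ∩ conv(A), the set of points of P lying in the convex hull of A, contains at least one point from each of the four colour classes. -/

import Mathlib

/-- `x` blocks `v` and `w` if `x` lies strictly between `v` and `w`. -/
def Blocks {E : Type*} [AddCommGroup E] [Module ℝ E] (x v w : E) : Prop :=
  x ∈ openSegment ℝ v w

/-- `v` and `w` are visible with respect to `P` if no point of `P` blocks them. -/
def Visible {E : Type*} [AddCommGroup E] [Module ℝ E] (P : Set E) (v w : E) : Prop :=
  ∀ x ∈ P, ¬ Blocks x v w

/-- `c` is a blocked colouring of `P`: distinct points of `P` are visible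
iff they get different colours. -/
def BlockedColouring {E : Type*} [AddCommGroup E] [Module ℝ E] {k : ℕ}
    (P : Set E) (c : E → Fin k) : Prop :=
  ∀ v ∈ P, ∀ w ∈ P, v ≠ w → (Visible P v w ↔ c v ≠ c w)

/-- `P` is `k`-blocked. -/
def KBlocked {E : Type*} [AddCommGroup E] [Module ℝ E] (k : ℕ) (P : Set E) : Prop :=
  P.Finite ∧ ∃ c : E → Fin k, BlockedColouring P c

/-- `P` is `{n₁,…,n_k}`-blocked where `N` is the multiset of colour class sizes. -/
def IsNBlocked {E : Type*} [AddCommGroup E] [Module ℝ E] (N : Multiset ℕ) (P : Set E) : Prop :=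
  P.Finite ∧ ∃ (k : ℕ) (c : E → Fin k), BlockedColouring P c ∧
    N = Finset.univ.val.map (fun i : Fin k => (P ∩ c ⁻¹' {i}).ncard)

/-- A multiset of positive integers is representable if some planar point set is
`N`-blocked. -/
def Representable (N : Multiset ℕ) : Prop :=
  ∃ P : Set (ℝ × ℝ), IsNBlocked N P

/-- A set is in convex position if no point lies in the convex hull of the others. -/
def ConvexPosition {E : Type*} [AddCommGroup E] [Module ℝ E] (K : Set E) : Prop :=
  ∀ x ∈ K, x ∉ convexHull ℝ (K \ {x})

/-- `P` is `N`-midpoint-blocked: `N`-blocked, and midpoints of monochromatic pairs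
belong to `P`. -/
def IsNMidpointBlocked {E : Type*} [AddCommGroup E] [Module ℝ E]
    (N : Multiset ℕ) (P : Set E) : Prop :=
  P.Finite ∧ ∃ (k : ℕ) (c : E → Fin k), BlockedColouring P c ∧
    (∀ v ∈ P, ∀ w ∈ P, v ≠ w → c v = c w → midpoint ℝ v w ∈ P) ∧
    N = Finset.univ.val.map (fun i : Fin k => (P ∩ c ⁻¹' {i}).ncard)

section Lines

variable {E : Type*} [NormedAddCommGroup E] [NormedSpace ℝ E] {k : ℕ} {P : Set E} {c : E → Fin k}

theorem blocks_iff_sbtw {x v w : E} (h : v ≠ w) : Blocks x v w ↔ Sbtw ℝ v x w := by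
  constructor
  · intro hx
    refine ⟨mem_segment_iff_wbtw.1 (openSegment_subset_segment ℝ v w hx), ?_, ?_⟩
    · rintro rfl
      exact h (left_mem_openSegment_iff.1 hx)
    · rintro rfl
      exact h (right_mem_openSegment_iff.1 hx)
  · intro hx
    exact mem_openSegment_of_ne_left_right hx.2.1.symm hx.2.2.symm hx.1.mem_segment

/-- Seen from `u`, some point of `P` on the segment towards `v ∈ P` is visible. -/
theorem exists_visible_wbtw (hfin : P.Finite) {u v : E} (hv : v ∈ P) (huv : u ≠ v) :
    ∃ w ∈ P, w ≠ u ∧ Wbtw ℝ u w v ∧ Visible P u w := by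
  obtain ⟨w, ⟨hwP, hwu, hw⟩, hmin⟩ := Set.exists_min_image {w | w ∈ P ∧ w ≠ u ∧ Wbtw ℝ u w v}
    (fun w => dist u w) (hfin.subset fun _ h => h.1) ⟨v, hv, huv.symm, wbtw_self_right ℝ u v⟩
  refine ⟨w, hwP, hwu, hw, fun x hx hb => ?_⟩
  rw [blocks_iff_sbtw hwu.symm] at hb
  have h₁ := hmin x ⟨hx, hb.2.1, hw.trans_left hb.1⟩
  have h₂ := hb.1.dist_add_dist
  have h₃ := dist_pos.2 hb.2.2
  linarith

namespace BlockedColouring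

theorem eq_of_sbtw (hc : BlockedColouring P c) {u x v : E} (hu : u ∈ P) (hx : x ∈ P) (hv : v ∈ P)
    (h : Sbtw ℝ u x v) : c u = c v := by
  by_contra hne
  exact (hc u hu v hv h.left_ne_right).2 hne x hx ((blocks_iff_sbtw h.left_ne_right).2 h)

theorem exists_wbtw_ne (hc : BlockedColouring P c) (hfin : P.Finite) {u v : E} (hu : u ∈ P)
    (hv : v ∈ P) (huv : u ≠ v) : ∃ w ∈ P, w ≠ u ∧ Wbtw ℝ u w v ∧ c w ≠ c u := by
  obtain ⟨w, hw, hwu, hb, hvis⟩ := exists_visible_wbtw hfin hv huv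
  exact ⟨w, hw, hwu, hb, ((hc u hu w hw hwu.symm).1 hvis).symm⟩

/-- Two points of the same colour are blocked by a point of a different colour. -/
theorem exists_sbtw_ne (hc : BlockedColouring P c) (hfin : P.Finite) {u v : E} (hu : u ∈ P)
    (hv : v ∈ P) (huv : u ≠ v) (h : c u = c v) : ∃ w ∈ P, Sbtw ℝ u w v ∧ c w ≠ c u := by
  obtain ⟨w, hw, hwu, hb, hcw⟩ := hc.exists_wbtw_ne hfin hu hv huv
  exact ⟨w, hw, ⟨hb, hwu, fun e => hcw (e ▸ h.symm)⟩, hcw⟩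

theorem not_sbtw_of_mono (hc : BlockedColouring P c) (hfin : P.Finite) {u v w : E} (hu : u ∈ P)
    (hv : v ∈ P) (hw : w ∈ P) (huv : c u = c v) : ¬ Sbtw ℝ u v w := by
  intro h
  obtain ⟨x, hx, hux, hcx⟩ := hc.exists_sbtw_ne hfin hu hv h.left_ne huv
  obtain ⟨y, hy, hyx, hxy, -⟩ := hc.exists_wbtw_ne hfin hx hv hux.ne_right
  have huxy : Sbtw ℝ u x y := ⟨hux.1.trans_right_left hxy, hux.ne_left, hyx.symm⟩
  have hcy := hc.eq_of_sbtw hu hx hy huxy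
  have huy : Wbtw ℝ u y v := hux.1.trans_right hxy
  have huyw : Sbtw ℝ u y w :=
    ⟨h.1.trans_left huy, huxy.left_ne_right.symm, h.trans_wbtw_left_ne huy⟩
  obtain ⟨z, hz, hzy, hyz, hcz⟩ := hc.exists_wbtw_ne hfin hy hw huyw.ne_right
  have huyz : Wbtw ℝ u y z := huyw.1.trans_right_left hyz
  have huxz : Sbtw ℝ u x z := Wbtw.trans_sbtw_left huyz huxy
  exact hcz ((hc.eq_of_sbtw hu hx hz huxz).symm.trans hcy)

/-- No three points of the same colour are collinear. -/
theorem not_collinear_of_mono (hc : BlockedColouring P c) (hfin : P.Finite) {u v w : E}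
    (hu : u ∈ P) (hv : v ∈ P) (hw : w ∈ P) (huv : u ≠ v) (huw : u ≠ w) (hvw : v ≠ w)
    (h₁ : c u = c v) (h₂ : c v = c w) : ¬ Collinear ℝ ({u, v, w} : Set E) := by
  intro h
  rcases h.wbtw_or_wbtw_or_wbtw with h | h | h
  · exact hc.not_sbtw_of_mono hfin hu hv hw h₁ ⟨h, huv.symm, hvw⟩
  · exact hc.not_sbtw_of_mono hfin hv hw hu h₂ ⟨h, hvw.symm, huw.symm⟩
  · exact hc.not_sbtw_of_mono hfin hw hu hv (h₁.trans h₂).symm ⟨h, huw, huv⟩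

end BlockedColouring

end Lines

section Triangles

/-- Twice the signed area of the triangle `p q r`. -/
def signedArea (p q r : ℝ × ℝ) : ℝ :=
  (q.1 - p.1) * (r.2 - p.2) - (q.2 - p.2) * (r.1 - p.1)

theorem signedArea_rotate (p q r : ℝ × ℝ) : signedArea q r p = signedArea p q r := by
  simp only [signedArea]
  ring

theorem signedArea_ne_zero_of_not_collinear {p q r : ℝ × ℝ}
    (h : ¬ Collinear ℝ ({p, q, r} : Set (ℝ × ℝ))) : signedArea p q r ≠ 0 := by
  contrapose! h
  by_cases hpq : q = p
  · subst hpq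
    simpa using collinear_pair ℝ q r
  rw [collinear_iff_of_mem (p₀ := p) (by simp)]
  refine ⟨q - p, ?_⟩
  simp only [signedArea] at h
  simp only [Set.mem_insert_iff, Set.mem_singleton_iff, forall_eq_or_imp, forall_eq]
  refine ⟨⟨0, by simp⟩, ⟨1, by simp⟩, ?_⟩
  by_cases h₁ : q.1 - p.1 = 0
  · have h₂ : q.2 - p.2 ≠ 0 := fun h₂ => hpq (Prod.ext (by linarith) (by linarith))
    refine ⟨(r.2 - p.2) / (q.2 - p.2), Prod.ext ?_ ?_⟩ <;>
      simp only [vadd_eq_add, Prod.fst_add, Prod.snd_add, Prod.smul_fst, Prod.smul_snd,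
        Prod.fst_sub, Prod.snd_sub, smul_eq_mul] <;> field_simp <;> linarith
  · refine ⟨(r.1 - p.1) / (q.1 - p.1), Prod.ext ?_ ?_⟩ <;>
      simp only [vadd_eq_add, Prod.fst_add, Prod.snd_add, Prod.smul_fst, Prod.smul_snd,
        Prod.fst_sub, Prod.snd_sub, smul_eq_mul] <;> field_simp <;> linarith

theorem signedArea_eq_zero_of_mem_openSegment {p q r : ℝ × ℝ} (h : r ∈ openSegment ℝ p q) :
    signedArea p q r = 0 := by
  obtain ⟨s, t, hs, ht, hst, rfl⟩ := h
  obtain rfl : s = 1 - t := by linarith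
  simp only [signedArea, Prod.fst_add, Prod.snd_add, Prod.smul_fst, Prod.smul_snd, smul_eq_mul]
  ring

theorem signedArea_ne_zero_of_openSegment {p q r w u : ℝ × ℝ} (h : signedArea p q r ≠ 0)
    (hw : w ∈ openSegment ℝ p q) (hu : u ∈ openSegment ℝ r w) : signedArea p q u ≠ 0 := by
  have h₀ := signedArea_eq_zero_of_mem_openSegment hw
  obtain ⟨s, t, hs, ht, hst, rfl⟩ := hu
  have : signedArea p q (s • r + t • w) = s * signedArea p q r + t * signedArea p q w := by
    obtain rfl : s = 1 - t := by linarith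
    simp only [signedArea, Prod.fst_add, Prod.snd_add, Prod.smul_fst, Prod.smul_snd, smul_eq_mul]
    ring
  rw [this, h₀, mul_zero, add_zero]
  exact mul_ne_zero hs.ne' h

theorem signedArea_inscribed_ne_zero {a b d x y z : ℝ × ℝ} (h : signedArea a b d ≠ 0)
    (hx : x ∈ openSegment ℝ b d) (hy : y ∈ openSegment ℝ d a) (hz : z ∈ openSegment ℝ a b) :
    signedArea x y z ≠ 0 := by
  obtain ⟨s₁, t₁, hs₁, ht₁, h₁, rfl⟩ := hx
  obtain ⟨s₂, t₂, hs₂, ht₂, h₂, rfl⟩ := hy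
  obtain ⟨s₃, t₃, hs₃, ht₃, h₃, rfl⟩ := hz
  have : signedArea (s₁ • b + t₁ • d) (s₂ • d + t₂ • a) (s₃ • a + t₃ • b) =
      (s₁ * s₂ * s₃ + t₁ * t₂ * t₃) * signedArea a b d := by
    obtain rfl : s₁ = 1 - t₁ := by linarith
    obtain rfl : s₂ = 1 - t₂ := by linarith
    obtain rfl : s₃ = 1 - t₃ := by linarith
    simp only [signedArea, Prod.fst_add, Prod.snd_add, Prod.smul_fst, Prod.smul_snd, smul_eq_mul]
    ring
  rw [this]
  exact mul_ne_zero (by positivity) h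

theorem left_mem_extremePoints_triangle {a b d : ℝ × ℝ} (h : signedArea a b d ≠ 0) :
    a ∈ (convexHull ℝ ({a, b, d} : Set (ℝ × ℝ))).extremePoints ℝ := by
  have key : ∀ p ∈ convexHull ℝ ({a, b, d} : Set (ℝ × ℝ)), p ≠ a →
      signedArea p b d / signedArea a b d < 1 := by
    intro p hp hpa
    rw [convexHull_insert (by simp), convexHull_pair, mem_convexJoin] at hp
    obtain ⟨e, he, q, ⟨s, t, -, -, hst, rfl⟩, ⟨α, β, -, hβ, hαβ, rfl⟩⟩ := hp
    obtain rfl : e = a := he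
    have hβ' : β ≠ 0 := by
      rintro rfl
      obtain rfl : α = 1 := by linarith
      simp at hpa
    have hlt : α < 1 := by
      have := lt_of_le_of_ne hβ hβ'.symm
      linarith
    rw [show signedArea (α • e + β • (s • b + t • d)) b d = α * signedArea e b d by
      obtain rfl : s = 1 - t := by linarith
      obtain rfl : α = 1 - β := by linarith
      simp only [signedArea, Prod.fst_add, Prod.snd_add, Prod.smul_fst, Prod.smul_snd, smul_eq_mul]
      ring, mul_div_cancel_right₀ _ h]
    exact hlt
  refine ⟨subset_convexHull ℝ _ (by simp), fun p hp q hq hseg => ?_⟩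
  by_contra hpa
  have hqa : q ≠ a := by
    rintro rfl
    exact hpa (right_mem_openSegment_iff.1 hseg)
  have hp' := key p hp hpa
  have hq' := key q hq hqa
  obtain ⟨s, t, hs, ht, hst, hpq⟩ := hseg
  have hcomb : s * (signedArea p b d / signedArea a b d) +
      t * (signedArea q b d / signedArea a b d) = 1 := by
    have : s * signedArea p b d + t * signedArea q b d = signedArea a b d := by
      rw [← hpq]
      obtain rfl : s = 1 - t := by linarith
      simp only [signedArea, Prod.fst_add, Prod.snd_add, Prod.smul_fst, Prod.smul_snd, smul_eq_mul]
      ring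
    field_simp
    exact this
  nlinarith

theorem mem_extremePoints_triangle {a b d : ℝ × ℝ} (h : signedArea a b d ≠ 0) {v : ℝ × ℝ}
    (hv : v ∈ ({a, b, d} : Set (ℝ × ℝ))) :
    v ∈ (convexHull ℝ ({a, b, d} : Set (ℝ × ℝ))).extremePoints ℝ := by
  have hrot : ∀ p q r : ℝ × ℝ, ({p, q, r} : Set (ℝ × ℝ)) = {q, r, p} := by
    intro p q r
    ext
    simp only [Set.mem_insert_iff, Set.mem_singleton_iff]
    tauto
  rcases hv with rfl | rfl | rfl
  · exact left_mem_extremePoints_triangle h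
  · rw [hrot]
    exact left_mem_extremePoints_triangle (by rwa [signedArea_rotate])
  · rw [hrot, hrot]
    exact left_mem_extremePoints_triangle (by rwa [signedArea_rotate, signedArea_rotate])

end Triangles

section MonochromaticTriangles

variable {P : Set (ℝ × ℝ)} {c : ℝ × ℝ → Fin 4} {i : Fin 4}

/-- `a`, `b`, `d` are three distinct points of `S` of the same colour. -/
structure MonoTriangle (c : ℝ × ℝ → Fin 4) (S : Set (ℝ × ℝ)) (a b d : ℝ × ℝ) : Prop where
  mem₁ : a ∈ S
  mem₂ : b ∈ S
  mem₃ : d ∈ S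
  ne₁₂ : a ≠ b
  ne₁₃ : a ≠ d
  ne₂₃ : b ≠ d
  eq₁₂ : c a = c b
  eq₂₃ : c b = c d

theorem MonoTriangle.signedArea_ne_zero {a b d : ℝ × ℝ} (h : MonoTriangle c P a b d)
    (hc : BlockedColouring P c) (hfin : P.Finite) : signedArea a b d ≠ 0 :=
  signedArea_ne_zero_of_not_collinear
    (hc.not_collinear_of_mono hfin h.mem₁ h.mem₂ h.mem₃ h.ne₁₂ h.ne₁₃ h.ne₂₃ h.eq₁₂ h.eq₂₃)

/-- In a minimal monochromatic triangle `a b d` missing colour `i`, the blockers `x`, `y` of two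
sides have different colours. Minimality enters through `hmin`. -/
theorem MonoTriangle.blocker_colour_ne {a b d x y z : ℝ × ℝ} (hc : BlockedColouring P c)
    (hfin : P.Finite) (h : MonoTriangle c P a b d)
    (hi : ∀ p ∈ P ∩ convexHull ℝ {a, b, d}, c p ≠ i)
    (hmin : ∀ p q r, MonoTriangle c (P ∩ convexHull ℝ {a, b, d}) p q r →
      ∀ v ∈ ({a, b, d} : Set (ℝ × ℝ)), v ∈ ({p, q, r} : Set (ℝ × ℝ)))
    (hxP : x ∈ P) (hyP : y ∈ P) (hzP : z ∈ P) (hx : x ∈ openSegment ℝ b d)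
    (hy : y ∈ openSegment ℝ d a) (hz : z ∈ openSegment ℝ a b)
    (hcx : c x ≠ c a) (hcz : c z ≠ c a) : c x ≠ c y := by
  intro hxy
  have harea := h.signedArea_ne_zero hc hfin
  have hxyz := signedArea_inscribed_ne_zero harea hx hy hz
  have hconv := convex_convexHull ℝ ({a, b, d} : Set (ℝ × ℝ))
  have hsub := subset_convexHull ℝ ({a, b, d} : Set (ℝ × ℝ))
  have haH := hsub (show a ∈ ({a, b, d} : Set (ℝ × ℝ)) by simp)
  have hbH := hsub (show b ∈ ({a, b, d} : Set (ℝ × ℝ)) by simp)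
  have hdH := hsub (show d ∈ ({a, b, d} : Set (ℝ × ℝ)) by simp)
  have hxH := hconv.openSegment_subset hbH hdH hx
  have hyH := hconv.openSegment_subset hdH haH hy
  have hzH := hconv.openSegment_subset haH hbH hz
  have hne_xy : x ≠ y := by
    rintro rfl
    simp [signedArea] at hxyz
  have hother : ∀ p q r, MonoTriangle c (P ∩ convexHull ℝ {a, b, d}) p q r → c p = c a := by
    intro p q r ht
    have := hmin p q r ht a (by simp)
    simp only [Set.mem_insert_iff, Set.mem_singleton_iff] at this
    rcases this with rfl | rfl | rfl
    · rfl
    · exact ht.eq₁₂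
    · exact ht.eq₁₂.trans ht.eq₂₃
  have hvertex : ∀ p ∈ P ∩ convexHull ℝ {a, b, d}, c p = c a →
      p ∈ ({a, b, d} : Set (ℝ × ℝ)) := by
    intro p hp hpa
    by_contra hpv
    simp only [Set.mem_insert_iff, Set.mem_singleton_iff, not_or] at hpv
    have := hmin a b p ⟨⟨h.mem₁, haH⟩, ⟨h.mem₂, hbH⟩, hp, h.ne₁₂, Ne.symm hpv.1, Ne.symm hpv.2.1,
      h.eq₁₂, h.eq₁₂.symm.trans hpa.symm⟩ d (by simp)
    simp only [Set.mem_insert_iff, Set.mem_singleton_iff] at this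
    rcases this with e | e | e
    · exact h.ne₁₃ e.symm
    · exact h.ne₂₃ e.symm
    · exact hpv.2.2 e.symm
  have hinner : ∀ p q r, p ∈ P → r ∈ P → p ∈ convexHull ℝ {a, b, d} →
      q ∈ convexHull ℝ {a, b, d} → r ∈ openSegment ℝ p q → c p ≠ c a → c r ≠ c a := by
    intro p q r _ hr hpH hqH hseg hcp hcr
    have hrH := hconv.openSegment_subset hpH hqH hseg
    have hext := mem_extremePoints_triangle harea (hvertex r ⟨hr, hrH⟩ hcr)
    exact hcp (hext.2 hpH hqH hseg ▸ hcr)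
  obtain ⟨w, hwP, hw, hcw⟩ := hc.exists_sbtw_ne hfin hxP hyP hne_xy hxy
  replace hw : w ∈ openSegment ℝ x y := (blocks_iff_sbtw hne_xy).2 hw
  have hwH := hconv.openSegment_subset hxH hyH hw
  have hcwa := hinner x y w hxP hwP hxH hyH hw hcx
  have hxi := hi x ⟨hxP, hxH⟩
  have hwi := hi w ⟨hwP, hwH⟩
  have hzi := hi z ⟨hzP, hzH⟩
  have hai := hi a ⟨h.mem₁, haH⟩
  have hne_zx : z ≠ x := by
    rintro rfl
    simp [signedArea] at hxyz
  have hne_zy : z ≠ y := by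
    rintro rfl
    apply hxyz
    simp only [signedArea]
    ring
  have hczx : c z ≠ c x := fun e => hcx
    (hother x y z ⟨⟨hxP, hxH⟩, ⟨hyP, hyH⟩, ⟨hzP, hzH⟩, hne_xy, hne_zx.symm, hne_zy.symm, hxy,
      hxy.symm.trans e.symm⟩)
  have hczw : c z = c w := by omega
  have hne_zw : z ≠ w := by
    rintro rfl
    exact hxyz (signedArea_eq_zero_of_mem_openSegment hw)
  obtain ⟨u, huP, hu, hcu⟩ := hc.exists_sbtw_ne hfin hzP hwP hne_zw hczw
  replace hu : u ∈ openSegment ℝ z w := (blocks_iff_sbtw hne_zw).2 hu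
  have huH := hconv.openSegment_subset hzH hwH hu
  have hcua := hinner z w u hzP huP hzH hwH hu hcz
  have hui := hi u ⟨huP, huH⟩
  have hcux : c u = c x := by omega
  have hxyu := signedArea_ne_zero_of_openSegment hxyz hw hu
  refine hcx (hother x y u ⟨⟨hxP, hxH⟩, ⟨hyP, hyH⟩, ⟨huP, huH⟩, hne_xy, ?_, ?_, hxy,
    hxy.symm.trans hcux.symm⟩)
  · rintro rfl
    simp [signedArea] at hxyu
  · rintro rfl
    apply hxyu
    simp only [signedArea]
    ring

theorem MonoTriangle.exists_colour (hc : BlockedColouring P c) (hfin : P.Finite) (i : Fin 4)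
    {a b d : ℝ × ℝ} (h : MonoTriangle c P a b d) :
    ∃ p ∈ P ∩ convexHull ℝ {a, b, d}, c p = i := by
  induction hn : (P ∩ convexHull ℝ ({a, b, d} : Set (ℝ × ℝ))).ncard using Nat.strong_induction_on
    generalizing a b d with
  | _ n ih =>
  by_contra! hi
  have harea := h.signedArea_ne_zero hc hfin
  have hconv := convex_convexHull ℝ ({a, b, d} : Set (ℝ × ℝ))
  have hsub := subset_convexHull ℝ ({a, b, d} : Set (ℝ × ℝ))
  have hSfin : (P ∩ convexHull ℝ ({a, b, d} : Set (ℝ × ℝ))).Finite :=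
    hfin.subset Set.inter_subset_left
  have hvP : ∀ v ∈ ({a, b, d} : Set (ℝ × ℝ)), v ∈ P := by
    rintro v (rfl | rfl | rfl)
    exacts [h.mem₁, h.mem₂, h.mem₃]
  have hmin : ∀ p q r, MonoTriangle c (P ∩ convexHull ℝ {a, b, d}) p q r →
      ∀ v ∈ ({a, b, d} : Set (ℝ × ℝ)), v ∈ ({p, q, r} : Set (ℝ × ℝ)) := by
    intro p q r ht v hv
    by_contra hvt
    have hle : convexHull ℝ ({p, q, r} : Set (ℝ × ℝ)) ⊆ convexHull ℝ {a, b, d} \ {v} := by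
      refine convexHull_min ?_
        (hconv.mem_extremePoints_iff_convex_sdiff.1 (mem_extremePoints_triangle harea hv)).2
      intro s hs
      refine ⟨?_, fun e => hvt (e ▸ hs)⟩
      rcases hs with rfl | rfl | rfl
      exacts [ht.mem₁.2, ht.mem₂.2, ht.mem₃.2]
    have hss : P ∩ convexHull ℝ ({p, q, r} : Set (ℝ × ℝ)) ⊂ P ∩ convexHull ℝ {a, b, d} :=
      ⟨fun s hs => ⟨hs.1, (hle hs.2).1⟩, fun hge => (hle (hge ⟨hvP v hv, hsub hv⟩).2).2 rfl⟩
    obtain ⟨s, hs, hsi⟩ := ih _ (hn ▸ Set.ncard_lt_ncard hss hSfin)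
      (a := p) (b := q) (d := r) ⟨ht.mem₁.1, ht.mem₂.1, ht.mem₃.1, ht.ne₁₂, ht.ne₁₃, ht.ne₂₃,
        ht.eq₁₂, ht.eq₂₃⟩ rfl
    exact hi s (hss.1 hs) hsi
  obtain ⟨x, hxP, hx, hcx⟩ := hc.exists_sbtw_ne hfin h.mem₂ h.mem₃ h.ne₂₃ h.eq₂₃
  obtain ⟨y, hyP, hy, hcy⟩ := hc.exists_sbtw_ne hfin h.mem₃ h.mem₁ h.ne₁₃.symm
    (h.eq₁₂.trans h.eq₂₃).symm
  obtain ⟨z, hzP, hz, hcz⟩ := hc.exists_sbtw_ne hfin h.mem₁ h.mem₂ h.ne₁₂ h.eq₁₂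
  replace hx : x ∈ openSegment ℝ b d := (blocks_iff_sbtw h.ne₂₃).2 hx
  replace hy : y ∈ openSegment ℝ d a := (blocks_iff_sbtw h.ne₁₃.symm).2 hy
  replace hz : z ∈ openSegment ℝ a b := (blocks_iff_sbtw h.ne₁₂).2 hz
  have haH := hsub (show a ∈ ({a, b, d} : Set (ℝ × ℝ)) by simp)
  have hbH := hsub (show b ∈ ({a, b, d} : Set (ℝ × ℝ)) by simp)
  have hdH := hsub (show d ∈ ({a, b, d} : Set (ℝ × ℝ)) by simp)
  have hai := hi a ⟨h.mem₁, haH⟩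
  have hxi := hi x ⟨hxP, hconv.openSegment_subset hbH hdH hx⟩
  have hyi := hi y ⟨hyP, hconv.openSegment_subset hdH haH hy⟩
  have hzi := hi z ⟨hzP, hconv.openSegment_subset haH hbH hz⟩
  have hrot : ({b, d, a} : Set (ℝ × ℝ)) = {a, b, d} := by
    ext
    simp only [Set.mem_insert_iff, Set.mem_singleton_iff]
    tauto
  have hrot' : ({d, a, b} : Set (ℝ × ℝ)) = {a, b, d} := by
    ext
    simp only [Set.mem_insert_iff, Set.mem_singleton_iff]
    tauto
  have hab := h.eq₁₂
  have hbd := h.eq₂₃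
  have hxy : c x ≠ c y := h.blocker_colour_ne hc hfin hi hmin hxP hyP hzP hx hy hz
    (by rwa [hab]) hcz
  have hbda : MonoTriangle c P b d a := ⟨h.mem₂, h.mem₃, h.mem₁, h.ne₂₃, h.ne₁₂.symm,
    h.ne₁₃.symm, h.eq₂₃, (h.eq₁₂.trans h.eq₂₃).symm⟩
  have hdab : MonoTriangle c P d a b := ⟨h.mem₃, h.mem₁, h.mem₂, h.ne₁₃.symm, h.ne₂₃.symm,
    h.ne₁₂, (h.eq₁₂.trans h.eq₂₃).symm, h.eq₁₂⟩
  have hyz : c y ≠ c z := hbda.blocker_colour_ne hc hfin (by rwa [hrot]) (by rwa [hrot])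
    hyP hzP hxP hy hz hx (by rwa [hbd]) hcx
  have hzx : c z ≠ c x := hdab.blocker_colour_ne hc hfin (by rwa [hrot']) (by rwa [hrot'])
    hzP hxP hyP hz hx hy (by rwa [← hbd, ← hab]) hcy
  omega

end MonochromaticTriangles

/-- If `A` is a set of three monochromatic points of a 4-blocked set `P`, then
`P ∩ conv(A)` contains a point from each of the four colour classes. -/
theorem mono_triangle_hull_all_colours (P : Set (ℝ × ℝ)) (hfin : P.Finite)
    (c : (ℝ × ℝ) → Fin 4) (hc : BlockedColouring P c)
    (a b d : ℝ × ℝ) (ha : a ∈ P) (hb : b ∈ P) (hd : d ∈ P)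
    (hab : a ≠ b) (had : a ≠ d) (hbd : b ≠ d)
    (hmono : c a = c b ∧ c b = c d) :
    ∀ i : Fin 4, ∃ p ∈ P ∩ convexHull ℝ ({a, b, d} : Set (ℝ × ℝ)), c p = i := by
  exact fun i => MonoTriangle.exists_colour hc hfin i
    ⟨ha, hb, hd, hab, had, hbd, hmono.1, hmono.2⟩
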